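/- For every integer n ≥ 7, the number of words w of length n over the alphabet {1,2,3} with no two adjacent letters equal such that w is a superpattern for [3]^3 and the prefix of w of length n−1 is not a superpattern for [3]^3 (i.e., w is a strict minimal superpattern) equals 6·((n−4)^2 − 2). -/

import Mathlib

/-- A word `w` of length `n` over the alphabet `{1,…,d}` (modeled as `Fin d`)
contains the pattern `p` of length `k` if some subsequence of `w` is
order-isomorphic to `p`. -/
def Contains {n k d : ℕ} (w : Fin n → Fin d) (p : Fin k → Fin d) : Prop :=
  ∃ f : Fin k → Fin n, StrictMono f ∧ ∀ a b : Fin k, w (f a) ≤ w (f b) ↔ p a ≤ p b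

/-- A word over a ternary alphabet is a superpattern for `[3]^3` if it contains
every pattern of length 3 over the ternary alphabet. -/
def Superpattern3 {n : ℕ} (w : Fin n → Fin 3) : Prop :=
  ∀ p : Fin 3 → Fin 3, Contains w p

/-- A word is minimal if no two adjacent letters are equal. -/
def MinimalWord {n : ℕ} (w : Fin n → Fin 3) : Prop :=
  ∀ (i : ℕ) (h : i + 1 < n), w ⟨i, Nat.lt_of_succ_lt h⟩ ≠ w ⟨i + 1, h⟩

/-- Remove the letter `c` from the front of `l`, if it is there. -/
def advance {α : Type*} [DecidableEq α] (c : α) : List α → List α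
  | [] => []
  | a :: l => if a = c then l else a :: l

theorem sublist_cons_iff_advance {α : Type*} [DecidableEq α] (c : α) (p l : List α) :
    p.Sublist (c :: l) ↔ (advance c p).Sublist l := by
  cases p with
  | nil => simp [advance]
  | cons a p =>
    by_cases h : a = c
    · subst h
      simp [advance]
    · simp only [advance, h, if_false]
      refine ⟨fun hs => ?_, fun hs => hs.cons c⟩
      cases hs with
      | cons _ hs => exact hs
      | cons_cons => exact absurd rfl h

theorem forall_sublist_cons_iff {α : Type*} [DecidableEq α] (c : α) (P : List (List α))
    (l : List α) :
    (∀ p ∈ P, p.Sublist (c :: l)) ↔ ∀ p ∈ P.map (advance c), p.Sublist l := by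
  simp [sublist_cons_iff_advance]

theorem forall_sublist_nil_iff {α : Type*} (P : List (List α)) :
    (∀ p ∈ P, p.Sublist []) ↔ P.all List.isEmpty = true := by
  simp

/-- A search, to depth `k`, certifying that every word having all members of `P` as subsequences
has some member of `Q` as a subsequence. -/
def forces {α : Type*} [DecidableEq α] (A : List α) :
    ℕ → List (List α) → List (List α) → Bool
  | 0, _, _ => false
  | k + 1, P, Q => Q.any List.isEmpty || (!P.all List.isEmpty && A.all fun c =>
      decide (P.map (advance c) = P ∧ Q.map (advance c) = Q) ||
        forces A k (P.map (advance c)) (Q.map (advance c)))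

theorem exists_sublist_of_forces {α : Type*} [DecidableEq α] {A : List α} (hA : ∀ c, c ∈ A)
    {k : ℕ} {P Q : List (List α)} (h : forces A k P Q = true) {l : List α}
    (hl : ∀ p ∈ P, p.Sublist l) : ∃ q ∈ Q, q.Sublist l := by
  induction k generalizing P Q l with
  | zero => simp [forces] at h
  | succ k ihk =>
    rw [forces, Bool.or_eq_true, Bool.and_eq_true] at h
    rcases h with h | ⟨hP, hc⟩
    · obtain ⟨q, hq, hq'⟩ := List.any_eq_true.1 h
      rw [List.isEmpty_iff] at hq'
      exact ⟨q, hq, hq' ▸ List.nil_sublist l⟩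
    · induction l with
      | nil =>
        rw [forall_sublist_nil_iff] at hl
        simp [hl] at hP
      | cons c l ihl =>
        rw [forall_sublist_cons_iff] at hl
        have hQ : ∃ q ∈ Q.map (advance c), q.Sublist l := by
          have hcc := List.all_eq_true.1 hc c (hA c)
          rw [Bool.or_eq_true, decide_eq_true_iff] at hcc
          rcases hcc with ⟨h1, h2⟩ | hcc
          · rw [h2]
            rw [h1] at hl
            exact ihl hl
          · exact ihk hcc hl
        obtain ⟨q, hq, hql⟩ := hQ
        obtain ⟨r, hr, rfl⟩ := List.mem_map.1 hq
        exact ⟨r, hr, (sublist_cons_iff_advance c r l).2 hql⟩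

theorem exists_strictMono_comp_eq_iff_sublist {α : Type*} {n k : ℕ} (w : Fin n → α)
    (q : Fin k → α) :
    (∃ f : Fin k → Fin n, StrictMono f ∧ w ∘ f = q) ↔
      (List.ofFn q).Sublist (List.ofFn w) := by
  rw [List.sublist_iff_exists_fin_orderEmbedding_get_eq]
  constructor
  · rintro ⟨f, hf, rfl⟩
    refine ⟨OrderEmbedding.ofStrictMono
      (fun i => Fin.cast (List.length_ofFn (f := w)).symm (f (Fin.cast List.length_ofFn i)))
      fun a b hab => hf hab, fun i => ?_⟩
    simp only [List.get_ofFn]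
    rfl
  · rintro ⟨f, hf⟩
    refine ⟨fun i => Fin.cast List.length_ofFn
      (f (Fin.cast (List.length_ofFn (f := q)).symm i)), fun a b hab => ?_, ?_⟩
    · exact f.strictMono (a := Fin.cast _ a) (b := Fin.cast _ b) hab
    · funext i
      have := hf (Fin.cast (List.length_ofFn (f := q)).symm i)
      simp only [List.get_ofFn] at this
      simpa using this.symm

theorem contains_iff_exists_sublist {n k d : ℕ} (w : Fin n → Fin d) (p : Fin k → Fin d) :
    Contains w p ↔ ∃ q : Fin k → Fin d, (∀ a b, q a ≤ q b ↔ p a ≤ p b) ∧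
      (List.ofFn q).Sublist (List.ofFn w) := by
  constructor
  · rintro ⟨f, hf, h⟩
    exact ⟨w ∘ f, h, (exists_strictMono_comp_eq_iff_sublist w _).1 ⟨f, hf, rfl⟩⟩
  · rintro ⟨q, h, hq⟩
    obtain ⟨f, hf, rfl⟩ := (exists_strictMono_comp_eq_iff_sublist w _).2 hq
    exact ⟨f, hf, h⟩

/-- The six permutations of the ternary alphabet. -/
def ternaryPerms : List (List (Fin 3)) :=
  [[0, 1, 2], [0, 2, 1], [1, 0, 2], [1, 2, 0], [2, 0, 1], [2, 1, 0]]

/-- The ternary words of length three that are order-isomorphic to `p`. -/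
def occurrences (p : Fin 3 → Fin 3) : List (Fin 3 → Fin 3) :=
  ((List.finRange 3).flatMap fun a => (List.finRange 3).flatMap fun b =>
    (List.finRange 3).map fun c => ![a, b, c]).filter
      fun q => ∀ a b, q a ≤ q b ↔ p a ≤ p b

theorem ternaryPerms_eq_ofFn : ∀ p ∈ ternaryPerms, ∃ q : Fin 3 → Fin 3, List.ofFn q = p ∧
    ∀ r : Fin 3 → Fin 3, (∀ a b, r a ≤ r b ↔ q a ≤ q b) → r = q := by
  decide +kernel

theorem forces_occurrences (p : Fin 3 → Fin 3) :
    forces (List.finRange 3) 20 ternaryPerms ((occurrences p).map List.ofFn) = true := by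
  revert p
  decide +kernel

theorem superpattern3_iff_forall_sublist {n : ℕ} (w : Fin n → Fin 3) :
    Superpattern3 w ↔ ∀ p ∈ ternaryPerms, p.Sublist (List.ofFn w) := by
  constructor
  · intro h p hp
    obtain ⟨q, rfl, hq⟩ := ternaryPerms_eq_ofFn p hp
    obtain ⟨r, hr, hs⟩ := (contains_iff_exists_sublist w q).1 (h q)
    exact hq r hr ▸ hs
  · intro h p
    obtain ⟨l, hl, hs⟩ := exists_sublist_of_forces List.mem_finRange (forces_occurrences p) h
    obtain ⟨q, hq, rfl⟩ := List.mem_map.1 hl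
    exact (contains_iff_exists_sublist w p).2
      ⟨q, by simpa using (List.mem_filter.1 hq).2, hs⟩

theorem minimalWord_iff_isChain {n : ℕ} (w : Fin n → Fin 3) :
    MinimalWord w ↔ (List.ofFn w).IsChain (· ≠ ·) := by
  simp [MinimalWord, List.isChain_iff_getElem]

theorem ofFn_castLE_eq_dropLast {α : Type*} {n : ℕ} (w : Fin n → α) :
    List.ofFn (fun i : Fin (n - 1) => w (Fin.castLE (Nat.sub_le n 1) i)) =
      (List.ofFn w).dropLast := by
  apply List.ext_getElem <;> simp

/-- The last letter read, if any, and the parts of the permutations still to be matched. -/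
abbrev ScanState := Option (Fin 3) × List (List (Fin 3))

/-- The continuations of a scan that keep adjacent letters distinct and complete the required
subsequences exactly at the last letter. -/
def IsStrictContinuation (s : ScanState) (l : List (Fin 3)) : Prop :=
  (s.1.toList ++ l).IsChain (· ≠ ·) ∧ (∀ p ∈ s.2, p.Sublist l) ∧
    (l = [] ∨ ¬ ∀ p ∈ s.2, p.Sublist l.dropLast)

/-- The state after reading the letter `d`. -/
def ScanState.read (s : ScanState) (d : Fin 3) : ScanState := (some d, s.2.map (advance d))

/-- The states that can follow `s`. -/
def ScanState.next (s : ScanState) : List ScanState :=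
  ((List.finRange 3).filter fun d => s.1 ≠ some d).map s.read

theorem isStrictContinuation_nil (s : ScanState) :
    IsStrictContinuation s [] ↔ s.2.all List.isEmpty = true := by
  obtain ⟨_ | c, P⟩ := s <;> simp [IsStrictContinuation]

theorem isStrictContinuation_cons (s : ScanState) (d : Fin 3) (l : List (Fin 3)) :
    IsStrictContinuation s (d :: l) ↔
      ¬ s.2.all List.isEmpty = true ∧ s.1 ≠ some d ∧ IsStrictContinuation (s.read d) l := by
  obtain ⟨c, P⟩ := s
  have hchain : (c.toList ++ d :: l).IsChain (· ≠ ·) ↔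
      c ≠ some d ∧ (d :: l).IsChain (· ≠ ·) := by
    cases c <;> simp
  have hdrop : (∀ p ∈ P, p.Sublist (d :: l).dropLast) ↔
      P.all List.isEmpty = true ∨ l ≠ [] ∧ ∀ p ∈ P.map (advance d), p.Sublist l.dropLast := by
    cases l with
    | nil => simp
    | cons e l =>
      rw [List.dropLast_cons_cons, forall_sublist_cons_iff]
      refine ⟨fun h => Or.inr ⟨by simp, h⟩, fun h => h.elim (fun h => ?_) fun h => h.2⟩
      rw [← forall_sublist_cons_iff]
      intro p hp
      rw [List.isEmpty_iff.1 (List.all_eq_true.1 h p hp)]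
      exact List.nil_sublist _
  simp only [IsStrictContinuation, ScanState.read, hchain, hdrop, forall_sublist_cons_iff,
    Option.toList_some, List.singleton_append]
  tauto

/-- The number of strict continuations of length `m`, computed recursively. -/
def strictCount : ℕ → ScanState → ℕ
  | 0, s => if s.2.all List.isEmpty then 1 else 0
  | m + 1, s => if s.2.all List.isEmpty then 0 else (s.next.map (strictCount m)).sum

theorem card_fin_succ_eq_sum {α : Type*} [Fintype α] {m : ℕ} (Q : (Fin (m + 1) → α) → Prop) :
    Nat.card {v // Q v} = ∑ a, Nat.card {v : Fin m → α // Q (Fin.cons a v)} := by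
  rw [← Nat.card_sigma]
  refine Nat.card_congr (((Fin.consEquiv fun _ => α).symm.subtypeEquiv
    (q := fun x => Q (Fin.cons x.1 x.2)) fun v => ?_).trans
      (Equiv.subtypeProdEquivSigmaSubtype fun a v => Q (Fin.cons a v)))
  simp [Fin.consEquiv]

theorem card_isStrictContinuation (m : ℕ) (s : ScanState) :
    Nat.card {v : Fin m → Fin 3 // IsStrictContinuation s (List.ofFn v)} = strictCount m s := by
  induction m generalizing s with
  | zero =>
    simp only [List.ofFn_zero, isStrictContinuation_nil, strictCount]
    split_ifs with h <;> simp [h]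
  | succ m ih =>
    rw [card_fin_succ_eq_sum, strictCount]
    simp only [List.ofFn_cons, isStrictContinuation_cons]
    split_ifs with h
    · simp [h]
    · have hd (d : Fin 3) : Nat.card {v : Fin m → Fin 3 // ¬ s.2.all List.isEmpty = true ∧
          s.1 ≠ some d ∧ IsStrictContinuation (s.read d) (List.ofFn v)} =
          if s.1 ≠ some d then strictCount m (s.read d) else 0 := by
        split_ifs with hs
        · rw [← ih]
          simp only [h, hs, not_false_eq_true, true_and, ne_eq, Bool.false_eq_true]
        · simp [hs]
      rw [Finset.sum_congr rfl fun d _ => hd d, Fin.sum_univ_def, ScanState.next, List.map_map]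
      induction List.finRange 3 with
      | nil => rfl
      | cons d L ihL =>
        rw [List.map_cons, List.sum_cons, ihL, List.filter_cons]
        split_ifs <;> simp_all

/-- The third difference of `f` vanishes at `m`. -/
def ThirdDifferenceZero (f : ℕ → ℕ) (m : ℕ) : Prop :=
  f (m + 3) + 3 * f (m + 1) = 3 * f (m + 2) + f m

instance (f : ℕ → ℕ) (m : ℕ) : Decidable (ThirdDifferenceZero f m) :=
  inferInstanceAs (Decidable (_ = _))

theorem thirdDifferenceZero_strictCount_succ {s : ScanState} {m : ℕ}
    (h : ∀ t ∈ s.next, ThirdDifferenceZero (strictCount · t) m) :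
    ThirdDifferenceZero (strictCount · s) (m + 1) := by
  have hsum (L : List ScanState) (hL : ∀ t ∈ L, ThirdDifferenceZero (strictCount · t) m) :
      ThirdDifferenceZero (fun k => (L.map (strictCount k)).sum) m := by
    induction L with
    | nil => rfl
    | cons t L ih =>
      have ht := hL t (by simp)
      have hL' := ih fun u hu => hL u (by simp [hu])
      simp only [ThirdDifferenceZero, List.map_cons, List.sum_cons] at ht hL' ⊢
      lia
  have hs := hsum _ h
  simp only [ThirdDifferenceZero, strictCount] at hs ⊢
  split_ifs
  · rfl
  · exact hs

/-- Depth-first search, with bounded fuel, for the states reachable from a list of states. -/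
def exploreStates : ℕ → List ScanState → List ScanState → List ScanState
  | 0, _, seen => seen
  | _ + 1, [], seen => seen
  | k + 1, s :: todo, seen =>
    if s ∈ seen then exploreStates k todo seen
    else exploreStates k (s.next ++ todo) (s :: seen)

/-- The states reachable from the start by reading at least one letter. -/
def reachableStates : List ScanState :=
  exploreStates 300 (ScanState.next (none, ternaryPerms)) []

theorem next_start_subset_reachableStates :
    ∀ t ∈ ScanState.next (none, ternaryPerms), t ∈ reachableStates := by
  decide +kernel

theorem next_mem_reachableStates : ∀ s ∈ reachableStates, ∀ t ∈ s.next, t ∈ reachableStates := by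
  decide +kernel

theorem thirdDifferenceZero_six :
    ∀ s ∈ reachableStates, ThirdDifferenceZero (strictCount · s) 6 := by
  decide +kernel

theorem thirdDifferenceZero_of_mem_reachableStates (m : ℕ) :
    ∀ s ∈ reachableStates, ThirdDifferenceZero (strictCount · s) (m + 6) := by
  induction m with
  | zero => exact thirdDifferenceZero_six
  | succ m ih =>
    intro s hs
    rw [Nat.add_right_comm]
    exact thirdDifferenceZero_strictCount_succ fun t ht =>
      ih t (next_mem_reachableStates s hs t ht)

theorem strictCount_start_initial :
    strictCount 7 (none, ternaryPerms) = 42 ∧ strictCount 8 (none, ternaryPerms) = 84 ∧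
      strictCount 9 (none, ternaryPerms) = 138 := by
  decide +kernel

theorem strictCount_start (m : ℕ) :
    strictCount (m + 7) (none, ternaryPerms) + 12 = 6 * (m + 3) ^ 2 := by
  induction m using Nat.strong_induction_on with
  | _ m ih =>
    obtain ⟨h7, h8, h9⟩ := strictCount_start_initial
    match m, ih with
    | 0, _ => simp [h7]
    | 1, _ => simp [h8]
    | 2, _ => simp [h9]
    | k + 3, ih =>
      have h0 := ih k (by lia)
      have h1 := ih (k + 1) (by lia)
      have h2 := ih (k + 2) (by lia)
      have hrec : ThirdDifferenceZero (strictCount · (none, ternaryPerms)) (k + 6 + 1) :=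
        thirdDifferenceZero_strictCount_succ fun t ht =>
          thirdDifferenceZero_of_mem_reachableStates k t (next_start_subset_reachableStates t ht)
      simp only [ThirdDifferenceZero] at hrec
      ring_nf at h0 h1 h2 hrec ⊢
      lia

/-- For `n ≥ 7`, the number of strict minimal superpatterns of length `n` for
`[3]^3` (minimal superpatterns whose length-`(n-1)` prefix is not a
superpattern) equals `6·((n-4)² − 2)`. -/
theorem strict_minimal_superpattern_count (n : ℕ) (hn : 7 ≤ n) :
    Nat.card {w : Fin n → Fin 3 //
      MinimalWord w ∧ Superpattern3 w ∧
      ¬ Superpattern3 (fun i : Fin (n - 1) => w (Fin.castLE (Nat.sub_le n 1) i))} =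
    6 * ((n - 4) ^ 2 - 2) := by
  have hiff (w : Fin n → Fin 3) : (MinimalWord w ∧ Superpattern3 w ∧
      ¬ Superpattern3 (fun i : Fin (n - 1) => w (Fin.castLE (Nat.sub_le n 1) i))) ↔
      IsStrictContinuation (none, ternaryPerms) (List.ofFn w) := by
    rw [minimalWord_iff_isChain, superpattern3_iff_forall_sublist,
      superpattern3_iff_forall_sublist, ofFn_castLE_eq_dropLast, IsStrictContinuation]
    have hne : List.ofFn w ≠ [] := by
      rw [Ne, List.ofFn_eq_nil_iff]
      lia
    simp only [hne, false_or, Option.toList_none, List.nil_append]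
  simp only [hiff, card_isStrictContinuation]
  obtain ⟨m, rfl⟩ := Nat.exists_eq_add_of_le' hn
  have h := strictCount_start m
  have h4 : m + 7 - 4 = m + 3 := by lia
  rw [h4]
  lia
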